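/- arXiv:1210.8069 — 5 statements merged into one kernel-verified Lean document; each statement's English description precedes it below -/
import Mathlib

section
/- For every positive integer n, the n×n rational matrix Ω whose (i,j) entry (indices 1 ≤ i,j ≤ n) is j·binom(i+1, j+1) is invertible, and its inverse Ω⁻¹ has (i,j) entry (−1)^{i−j}·(1/i)·binom(i+1, j+1). -/
/-- The `n × n` rational matrix `Ω` whose `(i,j)` entry (1-indexed) is
`j * binom (i+1) (j+1)`; here indices are 0-indexed, so the entry at `(i,j)` is
`(j+1) * binom (i+2) (j+2)`. -/
def OmegaMat (n : ℕ) : Matrix (Fin n) (Fin n) ℚ :=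
  Matrix.of fun i j => (((j : ℕ) + 1 : ℚ)) * (Nat.choose ((i : ℕ) + 2) ((j : ℕ) + 2) : ℚ)

/-- Orthogonality of binomial coefficients, with both indices shifted by `a`. -/
theorem sum_range_choose_mul_neg_one_pow_mul_choose {R : Type*} [CommRing R] (a : ℕ) {n i : ℕ}
    (hi : i < n) (j : ℕ) :
    ∑ k ∈ Finset.range n,
      ((i + a).choose (k + a) : R) * ((-1) ^ (k - j) * ((k + a).choose (j + a) : R)) =
      if i = j then 1 else 0 := by
  have hsub : Finset.Ico j (i + 1) ⊆ Finset.range n := by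
    intro k hk
    simp only [Finset.mem_Ico, Finset.mem_range] at hk ⊢
    omega
  rw [← Finset.sum_subset hsub]
  · rcases lt_or_ge i j with h | h
    · rw [Finset.Ico_eq_empty_of_le (by omega), Finset.sum_empty, if_neg (by omega)]
    · obtain ⟨d, rfl⟩ := Nat.exists_eq_add_of_le h
      rw [Finset.sum_Ico_eq_sum_range]
      have hterm : ∀ t ∈ Finset.range (j + d + 1 - j),
          ((j + d + a).choose (j + t + a) : R) *
            ((-1) ^ (j + t - j) * ((j + t + a).choose (j + a) : R)) =
          ((j + d + a).choose (j + a) : R) * (((-1) ^ t * (d.choose t : ℤ) : ℤ) : R) := by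
        intro t _
        have hmul := Nat.choose_mul (n := j + d + a) (k := j + t + a) (s := j + a) (by omega)
        rw [show j + d + a - (j + a) = d by omega, show j + t + a - (j + a) = t by omega] at hmul
        have hcast := congrArg (Nat.cast : ℕ → R) hmul
        push_cast at hcast ⊢
        rw [Nat.add_sub_cancel_left, mul_left_comm, hcast]
        ring
      rw [Finset.sum_congr rfl hterm, ← Finset.mul_sum, ← Int.cast_sum,
        show j + d + 1 - j = d + 1 by omega, Int.alternating_sum_range_choose]
      rcases eq_or_ne d 0 with rfl | hd
      · simp
      · simp [hd]
  · intro k _ hk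
    simp only [Finset.mem_Ico, not_and_or, not_le, not_lt] at hk
    rcases hk with hk | hk
    · rw [Nat.choose_eq_zero_of_lt (show k + a < j + a by omega)]
      simp
    · rw [Nat.choose_eq_zero_of_lt (show i + a < k + a by omega)]
      simp

/-- The matrix `Ω` is invertible and its inverse has `(i,j)` entry (1-indexed)
`(-1)^(i-j) * (1/i) * binom (i+1) (j+1)`. -/
theorem omega_isUnit_and_inv (n : ℕ) :
    IsUnit (OmegaMat n) ∧
    (OmegaMat n)⁻¹ = Matrix.of (fun i j : Fin n =>
      (-1 : ℚ) ^ ((i : ℕ) - (j : ℕ)) * (1 / ((i : ℕ) + 1)) *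
        (Nat.choose ((i : ℕ) + 2) ((j : ℕ) + 2) : ℚ)) := by
  have hmul : OmegaMat n * Matrix.of (fun i j : Fin n =>
      (-1 : ℚ) ^ ((i : ℕ) - (j : ℕ)) * (1 / ((i : ℕ) + 1)) *
        (Nat.choose ((i : ℕ) + 2) ((j : ℕ) + 2) : ℚ)) = 1 := by
    ext i j
    have hsum := sum_range_choose_mul_neg_one_pow_mul_choose (R := ℚ) 2 i.isLt j
    rw [← Fin.sum_univ_eq_sum_range (fun k => ((i + 2 : ℕ).choose (k + 2) : ℚ) *
      ((-1) ^ (k - (j : ℕ)) * ((k + 2).choose (j + 2) : ℚ)))] at hsum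
    simp only [Matrix.mul_apply, OmegaMat, Matrix.of_apply, Matrix.one_apply, Fin.ext_iff]
    rw [← hsum]
    refine Finset.sum_congr rfl fun k _ => ?_
    have hk : ((k : ℕ) + 1 : ℚ) ≠ 0 := by positivity
    field_simp
  exact ⟨IsUnit.of_mul_eq_one _ hmul, Matrix.inv_eq_right_inv hmul⟩
end

section
/- Let Ω be the n×n rational matrix with (i,j) entry j·binom(i+1, j+1) and Ψ the n×n rational matrix with (i,j) entry binom(i−1, j−1) (indices 1 ≤ i,j ≤ n). Then the matrix Ψ·Ω⁻¹ has (i,j) entry 1/i if i = j, −1/i if i = j+1, and 0 otherwise. -/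
/-- The `n × n` rational matrix `Ψ` whose `(i,j)` entry (1-indexed) is
`binom (i-1) (j-1)` (here written 0-indexed). -/
def PsiMat (n : ℕ) : Matrix (Fin n) (Fin n) ℚ :=
  Matrix.of fun i j => (Nat.choose (i : ℕ) (j : ℕ) : ℚ)

lemma det_OmegaMat (n : ℕ) : (OmegaMat n).det = ∏ i : Fin n, ((i : ℕ) + 1 : ℚ) := by
  rw [Matrix.det_of_isLowerTriangular]
  · simp [OmegaMat]
  · intro i j hij
    have hij : (i : ℕ) < j := hij
    simp [OmegaMat, Nat.choose_eq_zero_of_lt (show (i : ℕ) + 2 < j + 2 by lia)]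

lemma isUnit_det_OmegaMat (n : ℕ) : IsUnit (OmegaMat n).det := by
  rw [det_OmegaMat, isUnit_iff_ne_zero]
  exact Finset.prod_ne_zero_iff.mpr fun i _ => by positivity

/-- The bidiagonal matrix of the main theorem times `Ω` is `Ψ`. -/
lemma bidiagonal_mul_OmegaMat (n : ℕ) :
    Matrix.of (fun i j : Fin n =>
      if i = j then 1 / ((i : ℕ) + 1 : ℚ)
      else if (i : ℕ) = (j : ℕ) + 1 then -(1 / ((i : ℕ) + 1 : ℚ))
      else 0) * OmegaMat n = PsiMat n := by
  ext i j
  have hsplit : ∀ k : Fin n,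
      (if i = k then 1 / ((i : ℕ) + 1 : ℚ)
        else if (i : ℕ) = (k : ℕ) + 1 then -(1 / ((i : ℕ) + 1 : ℚ)) else 0) * OmegaMat n k j =
      (if i = k then 1 / ((i : ℕ) + 1 : ℚ) * OmegaMat n k j else 0) -
        (if (i : ℕ) = (k : ℕ) + 1 then 1 / ((i : ℕ) + 1 : ℚ) * OmegaMat n k j else 0) := by
    intro k
    by_cases h : i = k
    · subst h; simp
    · split_ifs <;> ring
  simp only [Matrix.mul_apply, Matrix.of_apply, hsplit, Finset.sum_sub_distrib,
    Finset.sum_ite_eq, Finset.mem_univ, if_true]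
  obtain ⟨i, hi⟩ := i
  cases i with
  | zero =>
    rcases j with ⟨_ | j, hj⟩ <;> simp [OmegaMat, PsiMat, Nat.choose_eq_zero_of_lt]
  | succ m =>
    have hsum : ∀ k : Fin n, (m + 1 = (k : ℕ) + 1) ↔ (⟨m, by lia⟩ : Fin n) = k := by
      intro k
      simp [Fin.ext_iff]
    simp only [hsum, Finset.sum_ite_eq, Finset.mem_univ, if_true, OmegaMat, PsiMat,
      Matrix.of_apply]
    have hpascal : ((m + 3).choose (j + 2) : ℚ) =
        (m + 2).choose (j + 1) + (m + 2).choose (j + 2) := by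
      exact_mod_cast Nat.choose_succ_succ (m + 2) (j + 1)
    have habsorb : ((m : ℚ) + 2) * (m + 1).choose j = (m + 2).choose (j + 1) * ((j : ℕ) + 1) := by
      exact_mod_cast Nat.add_one_mul_choose_eq (m + 1) j
    have hm : (m : ℚ) + 1 + 1 ≠ 0 := by positivity
    rw [show m + 1 + 2 = m + 3 from rfl, hpascal]
    push_cast
    field_simp
    linear_combination -habsorb

/-- The matrix `Ψ · Ω⁻¹` has `(i,j)` entry (1-indexed) `1/i` if `i = j`,
`-1/i` if `i = j + 1`, and `0` otherwise. -/
theorem psi_mul_omega_inv (n : ℕ) :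
    PsiMat n * (OmegaMat n)⁻¹ = Matrix.of (fun i j : Fin n =>
      if i = j then 1 / ((i : ℕ) + 1 : ℚ)
      else if (i : ℕ) = (j : ℕ) + 1 then -(1 / ((i : ℕ) + 1 : ℚ))
      else 0) := by
  rw [← bidiagonal_mul_OmegaMat, Matrix.mul_nonsing_inv_cancel_right _ _ (isUnit_det_OmegaMat n)]
end

section
/- A point λ ∈ ℤ^n lies in the convex hull in ℚ^n of the n+1 points 0 and λ^l = (1, 2, …, l, 0, …, 0) for l = 1, …, n if and only if λ is an anti-lecture hall composition of length n bounded above by 1. -/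
/-- `lam` is an anti-lecture hall composition of length `n` bounded above by `t`:
`t ≥ λ₁/1 ≥ λ₂/2 ≥ ⋯ ≥ λₙ/n ≥ 0` (written without division; entries are 0-indexed,
so `lam i` is the `(i+1)`-st entry `λ_{i+1}`). -/
def IsALHC {n : ℕ} (t : ℤ) (lam : Fin n → ℤ) : Prop :=
  (∀ i : Fin n, lam i ≤ t * ((i : ℕ) + 1)) ∧
  (∀ i j : Fin n, (i : ℕ) + 1 = (j : ℕ) → lam j * ((i : ℕ) + 1) ≤ lam i * ((j : ℕ) + 1)) ∧
  (∀ i : Fin n, 0 ≤ lam i)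

/-- The vector `λ^l = (1, 2, …, l, 0, …, 0) ∈ ℚ^n`. -/
def alhcVertex (n l : ℕ) : Fin n → ℚ :=
  fun i => if (i : ℕ) < l then ((i : ℕ) + 1 : ℚ) else 0

theorem alhcVertex_zero (n : ℕ) : alhcVertex n 0 = 0 := by
  funext i
  simp [alhcVertex]

/-- The rational points satisfying the inequalities of an anti-lecture hall composition bounded
above by `1` form a convex set. -/
theorem convex_setOf_antiLectureHall (n : ℕ) :
    Convex ℚ {x : Fin n → ℚ | (∀ i, x i ≤ (i : ℕ) + 1) ∧
      (∀ i j : Fin n, (i : ℕ) + 1 = (j : ℕ) → x j * ((i : ℕ) + 1) ≤ x i * ((j : ℕ) + 1)) ∧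
      ∀ i, 0 ≤ x i} := by
  rintro x ⟨hx₁, hx₂, hx₃⟩ y ⟨hy₁, hy₂, hy₃⟩ a b ha hb hab
  refine ⟨fun i => ?_, fun i j hij => ?_, fun i => ?_⟩ <;>
    simp only [Pi.add_apply, Pi.smul_apply, smul_eq_mul]
  · have h₁ := mul_le_mul_of_nonneg_left (hx₁ i) ha
    have h₂ := mul_le_mul_of_nonneg_left (hy₁ i) hb
    calc a * x i + b * y i ≤ a * ((i : ℕ) + 1) + b * ((i : ℕ) + 1) := add_le_add h₁ h₂
      _ = (i : ℕ) + 1 := by rw [← add_mul, hab, one_mul]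
  · have h₁ := mul_le_mul_of_nonneg_left (hx₂ i j hij) ha
    have h₂ := mul_le_mul_of_nonneg_left (hy₂ i j hij) hb
    linarith
  · exact add_nonneg (mul_nonneg ha (hx₃ i)) (mul_nonneg hb (hy₃ i))

theorem sum_range_sub_succ_mul_ite (f : ℕ → ℚ) (c : ℚ) (i m : ℕ) :
    ∑ l ∈ Finset.range m, (f l - f (l + 1)) * (if i < l then c else 0) =
      if i < m then (f (i + 1) - f m) * c else 0 := by
  induction m with
  | zero => simp
  | succ m ih =>
    rw [Finset.sum_range_succ, ih]
    rcases lt_trichotomy i m with h | rfl | h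
    · rw [if_pos h, if_pos h, if_pos (by omega)]
      ring
    · simp
    · rw [if_neg (by omega), if_neg (by omega), if_neg (by omega)]
      simp

/-- The ratios `λ_k / k`, extended by `1` at `k = 0` and by `0` for `k > n`. -/
def alhcRatio {n : ℕ} (lam : Fin n → ℤ) : ℕ → ℚ
  | 0 => 1
  | k + 1 => if h : k < n then (lam ⟨k, h⟩ : ℚ) / (k + 1) else 0

theorem IsALHC.alhcRatio_succ_le {n : ℕ} {lam : Fin n → ℤ} (h : IsALHC 1 lam) (k : ℕ) :
    alhcRatio lam (k + 1) ≤ alhcRatio lam k := by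
  obtain ⟨h₁, h₂, h₃⟩ := h
  cases k with
  | zero =>
    simp only [alhcRatio]
    split_ifs with hn
    · have := h₁ ⟨0, hn⟩
      simp only [Nat.cast_zero, zero_add, mul_one, div_one] at this ⊢
      exact_mod_cast this
    · exact zero_le_one
  | succ k =>
    simp only [alhcRatio]
    split_ifs with hk hk' hk'
    · rw [div_le_div_iff₀ (by positivity) (by positivity)]
      exact_mod_cast h₂ ⟨k, hk'⟩ ⟨k + 1, hk⟩ rfl
    · omega
    · have : (0 : ℚ) ≤ lam ⟨k, hk'⟩ := by exact_mod_cast h₃ _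
      positivity
    · exact le_rfl

/-- A point `λ ∈ ℤ^n` lies in the convex hull in `ℚ^n` of the `n+1` points `0` and
`λ^l = (1, 2, …, l, 0, …, 0)`, `l = 1, …, n`, if and only if `λ` is an anti-lecture
hall composition of length `n` bounded above by `1`. -/
theorem mem_convexHull_iff_alhc (n : ℕ) (lam : Fin n → ℤ) :
    ((fun i => (lam i : ℚ)) ∈ convexHull ℚ
        (insert (0 : Fin n → ℚ) {x | ∃ l : ℕ, 1 ≤ l ∧ l ≤ n ∧ x = alhcVertex n l})) ↔
    IsALHC 1 lam := by
  constructor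
  · intro h
    have hsub := convexHull_min (t := {x : Fin n → ℚ | (∀ i, x i ≤ (i : ℕ) + 1) ∧
      (∀ i j : Fin n, (i : ℕ) + 1 = (j : ℕ) → x j * ((i : ℕ) + 1) ≤ x i * ((j : ℕ) + 1)) ∧
      ∀ i, 0 ≤ x i}) ?_ (convex_setOf_antiLectureHall n) h
    · obtain ⟨h₁, h₂, h₃⟩ := hsub
      beta_reduce at h₁ h₂ h₃
      refine ⟨fun i => ?_, fun i j hij => ?_, fun i => ?_⟩
      · rw [one_mul]
        exact_mod_cast h₁ i
      · exact_mod_cast h₂ i j hij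
      · exact_mod_cast h₃ i
    · have hvertex (l : ℕ) : (∀ i, alhcVertex n l i ≤ (i : ℕ) + 1) ∧
          (∀ i j : Fin n, (i : ℕ) + 1 = (j : ℕ) →
            alhcVertex n l j * ((i : ℕ) + 1) ≤ alhcVertex n l i * ((j : ℕ) + 1)) ∧
          ∀ i, 0 ≤ alhcVertex n l i := by
        refine ⟨fun i => ?_, fun i j hij => ?_, fun i => ?_⟩ <;> simp only [alhcVertex]
        · split_ifs
          · exact le_rfl
          · positivity
        · split_ifs
          · exact (mul_comm _ _).le
          · omega
          · rw [zero_mul]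
            positivity
          · simp
        · split_ifs
          · positivity
          · exact le_rfl
      rintro x (rfl | ⟨l, -, -, rfl⟩)
      · rw [← alhcVertex_zero]
        exact hvertex 0
      · exact hvertex l
  · intro h
    have hlast : alhcRatio lam (n + 1) = 0 := by simp [alhcRatio]
    have hsum : (fun i => (lam i : ℚ)) = ∑ l ∈ Finset.range (n + 1),
        (alhcRatio lam l - alhcRatio lam (l + 1)) • alhcVertex n l := by
      funext i
      simp only [Finset.sum_apply, Pi.smul_apply, smul_eq_mul, alhcVertex]
      rw [sum_range_sub_succ_mul_ite, if_pos (by omega), hlast, sub_zero]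
      simp only [alhcRatio, i.isLt, dif_pos, Fin.eta]
      field_simp
    rw [hsum]
    refine (convex_convexHull ℚ _).sum_mem (fun l _ => sub_nonneg.2 (h.alhcRatio_succ_le l)) ?_
      fun l hl => subset_convexHull ℚ _ ?_
    · rw [Finset.sum_range_sub', hlast, sub_zero, alhcRatio]
    · rcases Nat.eq_zero_or_pos l with rfl | hpos
      · exact Or.inl (alhcVertex_zero n)
      · exact Or.inr ⟨l, hpos, Nat.lt_succ_iff.1 (Finset.mem_range.1 hl), rfl⟩
end

section
/- For every positive integer t, every anti-lecture hall composition of length n bounded above by t can be written as a sum of t anti-lecture hall compositions of length n bounded above by 1. (This expresses the normality of the simplex Q_n of anti-lecture hall compositions.) -/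
/-- Cutting a nonnegative integer `x` into consecutive slices of length `m`. -/
theorem sum_range_max_min_sub_mul (x m : ℤ) (hx : 0 ≤ x) (hm : 0 ≤ m) (t : ℕ) :
    ∑ k ∈ Finset.range t, max 0 (min m (x - k * m)) = min x (t * m) := by
  induction t with
  | zero => simp [hx]
  | succ t ih =>
    rw [Finset.sum_range_succ, ih]
    push_cast
    rw [add_mul, one_mul]
    generalize (t : ℤ) * m = y
    omega

/-- Truncating `lam i / (i + 1) - k` to the unit interval preserves the anti-lecture hall
condition. -/
theorem IsALHC.slice {n : ℕ} {t : ℤ} {lam : Fin n → ℤ} (h : IsALHC t lam) (k : ℤ) :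
    IsALHC 1 fun i => max 0 (min ((i : ℤ) + 1) (lam i - k * ((i : ℤ) + 1))) := by
  obtain ⟨-, hanti, -⟩ := h
  refine ⟨fun i => ?_, fun i j hij => ?_, fun i => le_max_left _ _⟩
  · dsimp only
    omega
  · have hi : (0 : ℤ) ≤ (i : ℕ) + 1 := by positivity
    have hj : (0 : ℤ) ≤ (j : ℕ) + 1 := by positivity
    have hlam := hanti i j hij
    dsimp only
    rw [max_mul_of_nonneg _ _ hi, max_mul_of_nonneg _ _ hj, min_mul_of_nonneg _ _ hi,
      min_mul_of_nonneg _ _ hj, zero_mul, zero_mul]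
    exact max_le_max le_rfl (min_le_min (by linarith) (by linarith))

/-- Every anti-lecture hall composition of length `n` bounded above by `t` is a sum of
`t` anti-lecture hall compositions of length `n` bounded above by `1` (normality of the
simplex `Q_n` of anti-lecture hall compositions). -/
theorem alhc_sum_of_bounded_by_one (n t : ℕ) (ht : 0 < t) (lam : Fin n → ℤ)
    (h : IsALHC (t : ℤ) lam) :
    ∃ f : Fin t → (Fin n → ℤ), (∀ k, IsALHC 1 (f k)) ∧ ∀ i, lam i = ∑ k, f k i := by
  refine ⟨fun k i => max 0 (min ((i : ℤ) + 1) (lam i - (k : ℕ) * ((i : ℤ) + 1))),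
    fun k => h.slice (k : ℕ), fun i => ?_⟩
  rw [Fin.sum_univ_eq_sum_range
      (fun k : ℕ => max 0 (min ((i : ℤ) + 1) (lam i - k * ((i : ℤ) + 1)))) t,
    sum_range_max_min_sub_mul _ _ (h.2.2 i) (by positivity), min_eq_left (h.1 i)]
end

section
/- Let P_n ⊂ ℚ^n be the convex hull of the n row vectors of the matrix Ω, where Ω has (i,j) entry j·binom(i+1, j+1). For every positive integer m, every lattice point of the dilate m·P_n (i.e., every point of ℤ^n lying in m·P_n) can be written as a sum of m lattice points of P_n. (This expresses the normality of the lattice simplex P_n.) -/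
/-- The `i`-th row (1-indexed) of the matrix `Ω`, whose `(i,j)` entry is
`j * binom (i+1) (j+1)` (written 0-indexed below). -/
def omegaRow (n : ℕ) (i : Fin n) : Fin n → ℚ :=
  fun j => (((j : ℕ) + 1 : ℚ)) * (Nat.choose ((i : ℕ) + 2) ((j : ℕ) + 2) : ℚ)

/-- The simplex `P_n ⊂ ℚ^n`: the convex hull of the `n` rows of `Ω`. -/
def Psimplex (n : ℕ) : Set (Fin n → ℚ) :=
  convexHull ℚ {x | ∃ i : Fin n, x = omegaRow n i}

/-- Each row of `Ω` is a partial sum of columns `(k + 1) * binom k j`. -/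
theorem sum_range_succ_mul_choose (N j : ℕ) :
    ∑ k ∈ Finset.range N, ((k : ℚ) + 1) * (k.choose j : ℚ)
      = ((j : ℚ) + 1) * ((N + 1).choose (j + 2) : ℚ) := by
  induction N with
  | zero => simp [Nat.choose_eq_zero_of_lt]
  | succ N ih =>
    have h : ((N : ℚ) + 1) * (N.choose j : ℚ) = ((N + 1).choose (j + 1) : ℚ) * ((j : ℚ) + 1) := by
      exact_mod_cast Nat.add_one_mul_choose_eq N j
    rw [Finset.sum_range_succ, ih, h, Nat.choose_succ_succ (N + 1) (j + 1)]
    push_cast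
    ring

/-- Summation by parts against the partial sums of `a`. -/
theorem sum_range_sub_mul_sum_range (μ a : ℕ → ℚ) (n : ℕ) :
    ∑ i ∈ Finset.range n, (μ i - μ (i + 1)) * ∑ k ∈ Finset.range (i + 1), a k
      = ∑ k ∈ Finset.range n, a k * μ k - μ n * ∑ k ∈ Finset.range n, a k := by
  induction n with
  | zero => simp
  | succ n ih =>
    rw [Finset.sum_range_succ, ih, Finset.sum_range_succ (fun k => a k * μ k),
      Finset.sum_range_succ a]
    ring

/-- In the coordinates given by the columns `(k + 1) * binom k j`, the simplex consists of the
antitone sequences from `1` to `0`. -/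
theorem mem_Psimplex_iff (n : ℕ) (p : Fin n → ℚ) :
    p ∈ Psimplex n ↔ ∃ μ : ℕ → ℚ, Antitone μ ∧ μ 0 = 1 ∧ μ n = 0 ∧
      ∀ j : Fin n, p j = ∑ k ∈ Finset.range n, (((k : ℚ) + 1) * (k.choose j : ℚ)) * μ k := by
  constructor
  · intro hp
    refine convexHull_min (t := {p : Fin n → ℚ | ∃ μ : ℕ → ℚ, Antitone μ ∧ μ 0 = 1 ∧ μ n = 0 ∧
      ∀ j : Fin n, p j = ∑ k ∈ Finset.range n, (((k : ℚ) + 1) * (k.choose j : ℚ)) * μ k})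
      ?_ ?_ hp
    · rintro _ ⟨i, rfl⟩
      refine ⟨fun k => if k ≤ i then 1 else 0, ?_, by simp, by simp, fun j => ?_⟩
      · intro a b hab
        dsimp only
        split_ifs <;> first | omega | norm_num
      · have hs : (Finset.range n).filter (fun k => k ≤ (i : ℕ)) = Finset.range (i + 1) := by
          ext k
          simp only [Finset.mem_filter, Finset.mem_range]
          omega
        simp only [mul_ite, mul_one, mul_zero]
        rw [← Finset.sum_filter, hs, sum_range_succ_mul_choose]
        rfl
    · rintro p ⟨μ, hμ, hμ0, hμn, hp⟩ q ⟨ν, hν, hν0, hνn, hq⟩ a b ha hb hab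
      refine ⟨fun k => a * μ k + b * ν k, ?_, by simp [hμ0, hν0, hab], by simp [hμn, hνn],
        fun j => ?_⟩
      · intro k l hkl
        have h₁ := hμ hkl
        have h₂ := hν hkl
        dsimp only
        gcongr
      · simp only [Pi.add_apply, Pi.smul_apply, smul_eq_mul, hp, hq, Finset.mul_sum,
          ← Finset.sum_add_distrib]
        exact Finset.sum_congr rfl fun k _ => by ring
  · rintro ⟨μ, hμ, hμ0, hμn, hp⟩
    have hp' : p = ∑ i : Fin n, (μ i - μ (i + 1)) • omegaRow n i := by
      ext j
      have h := sum_range_sub_mul_sum_range μ (fun k => ((k : ℚ) + 1) * (k.choose j : ℚ)) n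
      rw [hμn, zero_mul, sub_zero] at h
      rw [hp, ← h, Finset.sum_apply, Finset.sum_range]
      refine Finset.sum_congr rfl fun i _ => ?_
      rw [sum_range_succ_mul_choose]
      rfl
    rw [hp']
    refine (convex_convexHull ℚ _).sum_mem (fun i _ => sub_nonneg.2 (hμ (Nat.le_succ _))) ?_
      fun i _ => subset_convexHull ℚ _ ⟨i, rfl⟩
    rw [← Finset.sum_range fun i => μ i - μ (i + 1), Finset.sum_range_sub', hμ0, hμn, sub_zero]

/-- The upper triangular Pascal matrix. -/
def pascalMatrix (R : Type*) [CommRing R] (n : ℕ) : Matrix (Fin n) (Fin n) R :=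
  Matrix.of fun j k => ((k : ℕ).choose j : R)

theorem det_pascalMatrix (R : Type*) [CommRing R] (n : ℕ) : (pascalMatrix R n).det = 1 := by
  rw [Matrix.det_of_isUpperTriangular]
  · simp [pascalMatrix]
  · intro i j hij
    simp only [pascalMatrix, Matrix.of_apply]
    rw [Nat.choose_eq_zero_of_lt (by exact hij), Nat.cast_zero]

/-- Cutting a nonnegative integer into slices of length `s`. -/
theorem sum_range_clamp (y s : ℤ) (hy : 0 ≤ y) (hs : 0 ≤ s) (m : ℕ) :
    ∑ r ∈ Finset.range m, max 0 (min s (y - r * s)) = min y (m * s) := by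
  induction m with
  | zero => simp [hy]
  | succ m ih =>
    rw [Finset.sum_range_succ, ih]
    push_cast
    rw [add_mul, one_mul]
    generalize (m : ℤ) * s = t
    omega

/-- Normality of `P_n`: every lattice point of the dilate `m · P_n` is a sum of `m`
lattice points of `P_n`. -/
theorem psimplex_normal (n m : ℕ) (hm : 0 < m) (x : Fin n → ℤ)
    (hx : (fun i => (x i : ℚ)) ∈ (fun p => (m : ℚ) • p) '' Psimplex n) :
    ∃ f : Fin m → (Fin n → ℤ),
      (∀ k, (fun i => (f k i : ℚ)) ∈ Psimplex n) ∧ ∀ i, x i = ∑ k, f k i := by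
  obtain ⟨p, hp, hpx⟩ := hx
  obtain ⟨μ, hμ, hμ0, hμn, hpμ⟩ := (mem_Psimplex_iff n p).1 hp
  obtain ⟨y, hy⟩ : ∃ y : Fin n → ℤ, (pascalMatrix ℤ n).mulVec y = x :=
    Matrix.mulVec_surjective_iff_isUnit.2
      ((Matrix.isUnit_iff_isUnit_det _).2 (by simp [det_pascalMatrix])) x
  have hyμ : ∀ k : Fin n, (y k : ℚ) = ((k : ℚ) + 1) * (m * μ k) := by
    refine congrFun (Matrix.mulVec_injective_of_isUnit
      ((Matrix.isUnit_iff_isUnit_det (pascalMatrix ℚ n)).2 (by simp [det_pascalMatrix]))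
      (a₁ := fun k => (y k : ℚ)) ?_)
    ext j
    have hj := congrFun hpx j
    simp only [Pi.smul_apply, smul_eq_mul, hpμ, ← hy, Finset.sum_range, Finset.mul_sum] at hj
    simp only [Matrix.mulVec, dotProduct, pascalMatrix, Matrix.of_apply] at hj ⊢
    push_cast at hj
    rw [← hj]
    exact Finset.sum_congr rfl fun k _ => by ring
  have hm0 : (0 : ℚ) ≤ m := Nat.cast_nonneg m
  refine ⟨fun r => (pascalMatrix ℤ n).mulVec
    fun k => max 0 (min ((k : ℤ) + 1) (y k - r * ((k : ℤ) + 1))), fun r => ?_, fun j => ?_⟩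
  · have hr : ((r : ℕ) : ℚ) + 1 ≤ m := by exact_mod_cast r.2
    refine (mem_Psimplex_iff n _).2 ⟨fun k => max 0 (min 1 (m * μ k - r)), ?_, ?_, ?_, fun j => ?_⟩
    · intro k l hkl
      have := hμ hkl
      dsimp only
      gcongr
    · simp only [hμ0, mul_one]
      rw [min_eq_left (by linarith), max_eq_right zero_le_one]
    · simp only [hμn, mul_zero]
      exact max_eq_left ((min_le_right _ _).trans (by simp))
    · rw [Finset.sum_range]
      simp only [Matrix.mulVec, dotProduct, pascalMatrix, Matrix.of_apply]
      push_cast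
      refine Finset.sum_congr rfl fun k _ => ?_
      have hk : (0 : ℚ) ≤ (k : ℚ) + 1 := by positivity
      rw [hyμ, mul_comm ((k : ℚ) + 1) ((k : ℕ).choose j : ℚ), mul_assoc,
        mul_max_of_nonneg _ _ hk, mul_min_of_nonneg _ _ hk, mul_zero, mul_one, mul_sub,
        mul_comm (r : ℚ)]
  · rw [← hy]
    simp only [Matrix.mulVec, dotProduct]
    rw [Finset.sum_comm]
    refine Finset.sum_congr rfl fun k _ => ?_
    have h0 : 0 ≤ μ k := hμn ▸ hμ k.2.le
    have h1 : μ k ≤ 1 := hμ0 ▸ hμ (Nat.zero_le _)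
    have hk : (0 : ℚ) ≤ (k : ℚ) + 1 := by positivity
    have hy0 : 0 ≤ y k := by
      have : (0 : ℚ) ≤ y k := by
        rw [hyμ]
        positivity
      exact_mod_cast this
    have hy1 : y k ≤ m * ((k : ℤ) + 1) := by
      have : (y k : ℚ) ≤ m * ((k : ℚ) + 1) := by
        rw [hyμ, mul_comm (m : ℚ) ((k : ℚ) + 1)]
        exact mul_le_mul_of_nonneg_left (mul_le_of_le_one_right hm0 h1) hk
      exact_mod_cast this
    rw [← Finset.mul_sum, ← Finset.sum_range fun r : ℕ =>
      max 0 (min ((k : ℤ) + 1) (y k - r * ((k : ℤ) + 1))),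
      sum_range_clamp _ _ hy0 (by positivity), min_eq_left hy1]
end
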